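/- Let a, b, c, d, x be points of the Euclidean plane ℝ², pairwise distinct, such that: b lies strictly between a and x; c lies strictly between d and x; b, c, x are not collinear; ∠ a b d > π/3; ∠ a c d > π/3; ∠ a b c = ∠ a b d + ∠ d b c; ∠ d c b = ∠ d c a + ∠ a c b; ∠ b x c < π/15; and dist b c < dist a c. Then dist a b < 1.28 · dist b c. -/

import Mathlib

open EuclideanGeometry Real

/-- Numerically, `sin 72° / sin 48° ≈ 1.2798`. -/
lemma sin_two_pi_div_five_lt : sin (2 * π / 5) < 1.28 * sin (4 * π / 15) := by
  have h1 : sin (2 * π / 5) = cos (π / 10) := by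
    rw [← cos_pi_div_two_sub]; congr 1; ring
  have h2 : sin (4 * π / 15) = 1 / 2 * cos (π / 10) + √3 / 2 * sin (π / 10) := by
    rw [show 4 * π / 15 = π / 6 + π / 10 by ring, sin_add, sin_pi_div_six, cos_pi_div_six]
  have hs : 0 < sin (π / 10) := sin_pos_of_pos_of_lt_pi (by positivity) (by linarith [pi_pos])
  have hsq : sin (π / 10) ^ 2 = (3 - √5) / 8 := by
    have h := cos_two_mul' (π / 10)
    rw [show 2 * (π / 10) = π / 5 by ring, cos_pi_div_five] at h
    linarith [sin_sq_add_cos_sq (π / 10)]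
  have h5 : √5 < 2.2361 := (sqrt_lt' (by norm_num)).2 (by norm_num)
  have key : 0.36 * cos (π / 10) < 0.64 * (√3 * sin (π / 10)) := by
    refine lt_of_pow_lt_pow_left₀ 2 (by positivity) ?_
    rw [mul_pow, mul_pow, mul_pow, sq_sqrt (by norm_num), cos_sq', hsq]
    linarith
  rw [h1, h2]
  linarith

lemma sin_lt_sin_of_lt_of_add_lt_pi {s t : ℝ} (hs : 0 ≤ s) (hst : s < t) (h : s + t < π) :
    sin s < sin t := by
  rw [← sub_pos, sin_sub_sin]
  have h1 : 0 < sin ((t - s) / 2) := sin_pos_of_pos_of_lt_pi (by linarith) (by linarith)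
  have h2 : 0 < cos ((t + s) / 2) := cos_pos_of_mem_Ioo ⟨by linarith, by linarith⟩
  positivity

theorem second_intermediate_estimate (a b c d x : EuclideanSpace ℝ (Fin 2))
    (hdistinct : [a, b, c, d, x].Pairwise (· ≠ ·))
    (hbx : Sbtw ℝ a b x) (hcx : Sbtw ℝ d c x)
    (hncol : ¬ Collinear ℝ ({b, c, x} : Set (EuclideanSpace ℝ (Fin 2))))
    (habd : ∠ a b d > π / 3) (hacd : ∠ a c d > π / 3)
    (hadd1 : ∠ a b c = ∠ a b d + ∠ d b c)
    (hadd2 : ∠ d c b = ∠ d c a + ∠ a c b)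
    (hx : ∠ b x c < π / 15)
    (hgreedy : dist b c < dist a c) :
    dist a b < 1.28 * dist b c := by
  have hab : a ≠ b := hbx.left_ne
  have hac : a ≠ c := by
    simp only [List.pairwise_cons, List.mem_cons] at hdistinct
    exact hdistinct.1 c (by simp)
  have hbc : b ≠ c := by
    rintro rfl
    exact hncol (by simpa using collinear_pair ℝ b x)
  have hpi := pi_pos
  have hdbc := angle_nonneg d b c
  have hacb := angle_nonneg a c b
  have hline := angle_add_angle_eq_pi_of_angle_eq_pi a hcx.angle₁₂₃_eq_pi
  have hacx := angle_add_angle_add_angle_eq_pi x hac.symm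
  have habc := angle_add_angle_add_angle_eq_pi c hab.symm
  rw [← hbx.angle_eq_left c, angle_comm c x a,
    ← hbx.symm.angle_eq_left c] at hacx
  rw [angle_comm b c a, angle_comm c a b] at habc
  have hA : 4 * π / 15 < ∠ b a c := by linarith
  have hC : ∠ a c b < 2 * π / 5 := by linarith
  have hsinA := sin_lt_sin_of_lt_of_add_lt_pi (by positivity) hA (by linarith)
  have hsinC := sin_lt_sin_of_lt_of_add_lt_pi hacb hC (by linarith)
  have hsin : sin (∠ a c b) < 1.28 * sin (∠ b a c) := by
    linarith [sin_two_pi_div_five_lt]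
  have hpos : 0 < sin (∠ b a c) :=
    sin_pos_of_pos_of_lt_pi (by linarith) (by linarith)
  have hlaw := law_sin a c b
  rw [dist_comm c b, dist_comm b a] at hlaw
  have hbc' : 0 < dist b c := dist_pos.2 hbc
  refine lt_of_mul_lt_mul_left ?_ hpos.le
  linarith [mul_lt_mul_of_pos_right hsin hbc']
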